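/- (Bandman–Zarhin) Let K be an algebraically closed field and m ≥ 1. Let w be a non-trivial element of the free group on m generators, and let w̃ : SL_2(K)^m → SL_2(K) be the induced word map, sending (g_1,…,g_m) to the image of w under the homomorphism from the free group to SL_2(K) mapping the i-th generator to g_i. Then every diagonalizable matrix g ∈ SL_2(K) with g ≠ −I lies in the image of w̃: there exists (g_1,…,g_m) ∈ SL_2(K)^m with w̃(g_1,…,g_m) = g. -/

import Mathlib

open Polynomial Matrix

namespace WordMapSL2

/-- The matrix `t • (v ⊗ φ) + Q` of determinant one, where `v = (1, a)`, `φ = (-b, 1)` and `Q` is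
lower unitriangular. Its inverse is obtained by exchanging `a` and `b` and negating `t`. -/
def pencil {R : Type*} [CommRing R] (a b t : R) : Matrix.SpecialLinearGroup (Fin 2) R :=
  ⟨!![1 - t * b, t; a - b - t * a * b, 1 + t * a], by rw [det_fin_two_of]; ring⟩

lemma coe_pencil_inv {R : Type*} [CommRing R] (a b t : R) :
    (((pencil a b t)⁻¹ : Matrix.SpecialLinearGroup (Fin 2) R) : Matrix (Fin 2) (Fin 2) R) =
      !![1 + t * a, -t; b - a + t * a * b, 1 - t * b] := by
  rw [Matrix.SpecialLinearGroup.coe_inv, pencil, adjugate_fin_two_of]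
  congr! 3
  ring_nf

variable {K ι : Type*} [Field K]

/-- The matrix over `K[X]` substituted for the letter `x`, given parameters `c` for the letters. -/
noncomputable def letter (c : ι × Bool → K) (x : ι × Bool) : Matrix.SpecialLinearGroup (Fin 2) K[X] :=
  cond x.2 (pencil (C (c (x.1, true))) (C (c (x.1, false))) X)
    (pencil (C (c (x.1, true))) (C (c (x.1, false))) X)⁻¹

lemma letter_entry (c : ι × Bool → K) (x : ι × Bool) :
    ∃ s : K, s ≠ 0 ∧ ∀ i j, (letter c x i j).natDegree ≤ 1 ∧
      (letter c x i j).coeff 1 = s * ![1, c x] i * ![-c (x.1, !x.2), 1] j := by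
  obtain ⟨k, _ | _⟩ := x
  · refine ⟨-1, by simp, fun i j => ?_⟩
    change (((pencil _ _ _)⁻¹ : Matrix.SpecialLinearGroup (Fin 2) K[X]) i j).natDegree ≤ 1 ∧
      (((pencil _ _ _)⁻¹ : Matrix.SpecialLinearGroup (Fin 2) K[X]) i j).coeff 1 = _
    rw [coe_pencil_inv]
    fin_cases i <;> fin_cases j <;> refine ⟨?_, ?_⟩ <;>
      simp [coeff_one, coeff_C, mul_assoc] <;> try compute_degree
    all_goals ring
  · refine ⟨1, by simp, fun i j => ?_⟩
    change (!![1 - X * C _, X; C _ - C _ - X * C _ * C _, 1 + X * C _] i j).natDegree ≤ 1 ∧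
      (!![1 - X * C _, X; C _ - C _ - X * C _ * C _, 1 + X * C _] i j).coeff 1 = _
    fin_cases i <;> fin_cases j <;> refine ⟨?_, ?_⟩ <;>
      simp [coeff_one, coeff_C, mul_assoc] <;> try compute_degree

lemma pairing_ne_zero {c : ι × Bool → K} (hc : Function.Injective c) {x y : ι × Bool}
    (h : x.1 = y.1 → x.2 = y.2) : c y - c (x.1, !x.2) ≠ 0 := by
  rw [sub_ne_zero]
  intro e
  have := hc e
  subst this
  simp at h

lemma prod_letter_entry {c : ι × Bool → K} (hc : Function.Injective c) (L : List (ι × Bool))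
    (x : ι × Bool) (h : FreeGroup.IsReduced (x :: L)) :
    ∃ s : K, s ≠ 0 ∧ ∀ i j,
      ((((x :: L).map (letter c)).prod : Matrix.SpecialLinearGroup (Fin 2) K[X]) i j).natDegree
        ≤ L.length + 1 ∧
      ((((x :: L).map (letter c)).prod : Matrix.SpecialLinearGroup (Fin 2) K[X]) i j).coeff
          (L.length + 1) =
        s * ![1, c x] i * ![-c (((x :: L).getLast (by simp)).1, !((x :: L).getLast (by simp)).2),
          1] j := by
  induction L generalizing x with
  | nil => simpa using letter_entry c x
  | cons y L ih =>
    rw [FreeGroup.IsReduced, List.isChain_cons_cons] at h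
    obtain ⟨s, hs, H⟩ := ih y h.2
    obtain ⟨r, hr, G⟩ := letter_entry c x
    refine ⟨r * s * (c y - c (x.1, !x.2)),
      mul_ne_zero (mul_ne_zero hr hs) (pairing_ne_zero hc h.1), fun i j => ?_⟩
    rw [List.map_cons, List.prod_cons, Matrix.SpecialLinearGroup.coe_mul, mul_apply, Fin.sum_univ_two,
      List.getLast_cons (by simp), List.length_cons]
    constructor
    · refine natDegree_add_le_of_degree_le ?_ ?_ <;>
      · rw [add_comm _ 1]
        exact natDegree_mul_le_of_le (G _ _).1 (H _ _).1
    · rw [add_comm _ 1, coeff_add, coeff_mul_add_eq_of_natDegree_le (G _ _).1 (H _ _).1,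
        coeff_mul_add_eq_of_natDegree_le (G _ _).1 (H _ _).1]
      simp only [(G _ _).2, (H _ _).2]
      simp only [cons_val_zero, cons_val_one]
      ring

lemma trace_prod_letter_natDegree_ne_zero {c : ι × Bool → K} (hc : Function.Injective c)
    {L : List (ι × Bool)} (hL : L ≠ []) (h : FreeGroup.IsCyclicallyReduced L) :
    (trace (((L.map (letter c)).prod : Matrix.SpecialLinearGroup (Fin 2) K[X]) :
      Matrix (Fin 2) (Fin 2) K[X])).natDegree ≠ 0 := by
  obtain _ | ⟨x, L⟩ := L
  · exact absurd rfl hL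
  obtain ⟨s, hs, H⟩ := prod_letter_entry hc L x h.1
  have hp := pairing_ne_zero hc (h.2 _ (List.getLast?_eq_getLast_of_ne_nil hL) x rfl)
  refine fun h0 => mul_ne_zero hs hp ?_
  rw [← coeff_eq_zero_of_natDegree_lt (h0.trans_lt L.length.succ_pos), trace_fin_two, coeff_add,
    Nat.succ_eq_add_one, (H _ _).2, (H _ _).2]
  simp only [cons_val_zero, cons_val_one]
  ring

/-- The trace of a nontrivial word map on `SL₂` over an algebraically closed field is surjective. -/
theorem exists_trace_lift_eq [IsAlgClosed K] [Finite ι] {w : FreeGroup ι} (hw : w ≠ 1) (τ : K) :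
    ∃ gs : ι → Matrix.SpecialLinearGroup (Fin 2) K,
      trace (FreeGroup.lift gs w : Matrix (Fin 2) (Fin 2) K) = τ := by
  classical
  have : Infinite K := IsAlgClosed.instInfinite
  cases nonempty_fintype (ι × Bool)
  obtain ⟨c⟩ : Nonempty ((ι × Bool) ↪ K) := by
    obtain ⟨e⟩ := Finite.exists_equiv_fin (ι × Bool) |>.choose_spec
    exact ⟨e.toEmbedding.trans (Fin.valEmbedding.trans (Infinite.natEmbedding K))⟩
  set gs : ι → Matrix.SpecialLinearGroup (Fin 2) K[X] := fun k => letter c (k, true)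
  set L := FreeGroup.reduceCyclically w.toWord
  set u := FreeGroup.mk (FreeGroup.reduceCyclically.conjugator w.toWord)
  have hwu : w = u * FreeGroup.mk L * u⁻¹ := by
    rw [FreeGroup.inv_mk, FreeGroup.mul_mk, FreeGroup.mul_mk,
      FreeGroup.reduceCyclically.conj_conjugator_reduceCyclically, FreeGroup.mk_toWord]
  have hL : L ≠ [] := by
    intro h
    rw [h, ← FreeGroup.one_eq_mk] at hwu
    exact hw (by simpa using hwu)
  have hlift : FreeGroup.lift gs (FreeGroup.mk L) = (L.map (letter c)).prod := by
    rw [FreeGroup.lift_mk]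
    rfl
  have htr : (trace (FreeGroup.lift gs w : Matrix (Fin 2) (Fin 2) K[X])).natDegree ≠ 0 := by
    rw [hwu, map_mul, map_mul, map_inv, Matrix.SpecialLinearGroup.coe_mul, trace_mul_comm,
      ← Matrix.SpecialLinearGroup.coe_mul, inv_mul_cancel_left, hlift]
    exact trace_prod_letter_natDegree_ne_zero c.injective hL
      (FreeGroup.reduceCyclically.isCyclicallyReduced FreeGroup.isReduced_toWord)
  obtain ⟨t, ht⟩ := IsAlgClosed.exists_root
    (trace (FreeGroup.lift gs w : Matrix (Fin 2) (Fin 2) K[X]) - C τ) (fun h => htr (by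
      rw [← natDegree_sub_C (a := τ)]
      exact natDegree_eq_of_degree_eq_some h))
  refine ⟨fun k => Matrix.SpecialLinearGroup.map (evalRingHom t) (gs k), ?_⟩
  have hmap : FreeGroup.lift (fun k => Matrix.SpecialLinearGroup.map (evalRingHom t) (gs k)) w =
      Matrix.SpecialLinearGroup.map (evalRingHom t) (FreeGroup.lift gs w) :=
    DFunLike.congr_fun (FreeGroup.ext_hom
      (f := FreeGroup.lift (fun k => Matrix.SpecialLinearGroup.map (evalRingHom t) (gs k)))
      (g := (Matrix.SpecialLinearGroup.map (evalRingHom t)).comp (FreeGroup.lift gs))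
      (fun k => by simp)) w
  rw [hmap]
  rw [IsRoot.def, eval_sub, eval_C, sub_eq_zero] at ht
  simpa [trace_fin_two] using ht

/-- A `2 × 2` matrix whose trace and determinant are those of a diagonal matrix with distinct
diagonal entries is conjugate to that diagonal matrix. -/
lemma exists_conj_eq_diagonal {α β : K} (hαβ : α ≠ β) {A : Matrix (Fin 2) (Fin 2) K}
    (htr : A.trace = α + β) (hdet : A.det = α * β) :
    ∃ R : GL (Fin 2) K, A * (R : Matrix (Fin 2) (Fin 2) K) =
      (R : Matrix (Fin 2) (Fin 2) K) * diagonal ![α, β] := by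
  rw [trace_fin_two] at htr
  rw [det_fin_two] at hdet
  have eigen (μ : K) (hμ : (μ - α) * (μ - β) = 0) : ∃ v ≠ 0, A *ᵥ v = μ • v := by
    obtain ⟨v, hv, h⟩ := exists_mulVec_eq_zero_iff (M := A - scalar (Fin 2) μ) |>.2 (by
      rw [det_fin_two]
      simp
      linear_combination hdet - μ * htr + hμ)
    refine ⟨v, hv, ?_⟩
    rw [sub_mulVec, sub_eq_zero] at h
    rw [h]
    ext i
    simp [mulVec_diagonal]
  obtain ⟨v, hv, hAv⟩ := eigen α (by simp)
  obtain ⟨u, hu, hAu⟩ := eigen β (by simp)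
  have v0 := congr_fun hAv 0
  have v1 := congr_fun hAv 1
  have u0 := congr_fun hAu 0
  have u1 := congr_fun hAu 1
  simp only [mulVec, dotProduct, Fin.sum_univ_two, Pi.smul_apply, smul_eq_mul] at v0 v1 u0 u1
  set R : Matrix (Fin 2) (Fin 2) K := !![v 0, u 0; v 1, u 1] with hR
  have hAR : A * R = R * diagonal ![α, β] := by
    ext i j
    fin_cases i <;> fin_cases j <;>
      simp [hR, mul_apply, Fin.sum_univ_two] <;> grind
  have hdetR : R.det ≠ 0 := by
    intro h0
    obtain ⟨x, hx, hRx⟩ := exists_mulVec_eq_zero_iff.2 h0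
    have e : x 0 • v + x 1 • u = 0 := by
      ext i
      have := congr_fun hRx i
      fin_cases i <;> simp [hR, mulVec, dotProduct, Fin.sum_univ_two] at this ⊢ <;>
        linear_combination this
    have e' : (x 0 * α) • v + (x 1 * β) • u = 0 := by
      have := congr_arg (A *ᵥ ·) e
      simpa [mulVec_add, mulVec_smul, hAv, hAu, smul_smul] using this
    have hx0 : (x 0 * (α - β)) • v = 0 := by
      have : (x 0 * (α - β)) • v =
          ((x 0 * α) • v + (x 1 * β) • u) - β • (x 0 • v + x 1 • u) := by module
      rw [this, e, e', smul_zero, sub_zero]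
    have hx0 : x 0 = 0 := by simpa [hv, sub_ne_zero.2 hαβ] using hx0
    have hx1 : x 1 = 0 := by simpa [hx0, hu] using e
    exact hx (by ext i; fin_cases i <;> assumption)
  exact ⟨GeneralLinearGroup.mkOfDetNeZero R hdetR, hAR⟩

/-- Conjugation by an element of `GL₂(K)`, as an endomorphism of `SL₂(K)`. -/
def conjHom (S : GL (Fin 2) K) :
    Matrix.SpecialLinearGroup (Fin 2) K →* Matrix.SpecialLinearGroup (Fin 2) K where
  toFun A := ⟨(S : Matrix (Fin 2) (Fin 2) K) * (A : Matrix (Fin 2) (Fin 2) K) *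
    ((S⁻¹ : GL (Fin 2) K) : Matrix (Fin 2) (Fin 2) K), by rw [det_units_conj, A.det_coe]⟩
  map_one' := by ext1; simp
  map_mul' A B := by
    apply Subtype.ext
    change (S : Matrix (Fin 2) (Fin 2) K) * (A.1 * B.1) * (S⁻¹ : GL (Fin 2) K).1 =
      (S.1 * A.1 * (S⁻¹ : GL (Fin 2) K).1) * (S.1 * B.1 * (S⁻¹ : GL (Fin 2) K).1)
    simp only [Matrix.mul_assoc, Units.inv_mul_cancel_left]

end WordMapSL2

open WordMapSL2 in
/-- (Bandman–Zarhin) For a non-trivial word `w` in the free group on `m` generators and an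
algebraically closed field `K`, every diagonalizable (semisimple) element of `SL₂(K)`
different from `-1` lies in the image of the word map induced by `w`. -/
theorem semisimple_in_image_of_word_map_SL2
    (K : Type*) [Field K] [IsAlgClosed K] (m : ℕ) (hm : 1 ≤ m)
    (w : FreeGroup (Fin m)) (hw : w ≠ 1)
    (g : Matrix.SpecialLinearGroup (Fin 2) K)
    (hdiag : ∃ P : GL (Fin 2) K,
      Matrix.IsDiag ((↑(P⁻¹) : Matrix (Fin 2) (Fin 2) K) * (↑g : Matrix (Fin 2) (Fin 2) K) *
        (↑P : Matrix (Fin 2) (Fin 2) K)))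
    (hg : (↑g : Matrix (Fin 2) (Fin 2) K) ≠ -1) :
    ∃ gs : Fin m → Matrix.SpecialLinearGroup (Fin 2) K, FreeGroup.lift gs w = g := by
  obtain ⟨P, hP⟩ := hdiag
  set D := (↑(P⁻¹) : Matrix (Fin 2) (Fin 2) K) * (↑g : Matrix (Fin 2) (Fin 2) K) *
    (↑P : Matrix (Fin 2) (Fin 2) K) with hD
  have hgD : (g : Matrix (Fin 2) (Fin 2) K) = P * D * (P⁻¹ : GL (Fin 2) K) := by
    simp [hD, Matrix.mul_assoc]
  have hDdiag : D = diagonal ![D 0 0, D 1 1] := by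
    rw [← hP.diagonal_diag]
    congr 1
    ext i
    fin_cases i <;> simp
  have hdet : D 0 0 * D 1 1 = 1 := by
    have h : D.det = 1 := by rw [hD, det_units_conj', g.det_coe]
    rw [hDdiag, det_diagonal] at h
    simpa using h
  have htr : trace (g : Matrix (Fin 2) (Fin 2) K) = D 0 0 + D 1 1 := by
    rw [hgD, trace_units_conj, trace_fin_two]
  by_cases hαβ : D 0 0 = D 1 1
  · have hDs : D = D 0 0 • (1 : Matrix (Fin 2) (Fin 2) K) := by
      ext i j
      rw [hDdiag]
      fin_cases i <;> fin_cases j <;> simp [hαβ]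
    have hgs : (g : Matrix (Fin 2) (Fin 2) K) = D 0 0 • 1 := by
      rw [hgD, hDs]
      simp
    rw [← hαβ, mul_self_eq_one_iff] at hdet
    obtain h | h := hdet
    · refine ⟨1, ?_⟩
      have hlift : FreeGroup.lift (1 : Fin m → Matrix.SpecialLinearGroup (Fin 2) K) = 1 :=
        FreeGroup.ext_hom _ _ (fun k => by simp)
      rw [hlift]
      exact Subtype.ext (by simp [hgs, h])
    · exact absurd (by simp [hgs, h]) hg
  · obtain ⟨gs, hgs⟩ := exists_trace_lift_eq hw (D 0 0 + D 1 1)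
    obtain ⟨R, hR⟩ := exists_conj_eq_diagonal hαβ hgs
      (by rw [hdet, Matrix.SpecialLinearGroup.det_coe])
    rw [← hDdiag] at hR
    refine ⟨fun k => conjHom (P * R⁻¹) (gs k), ?_⟩
    have hlift : FreeGroup.lift (fun k => conjHom (P * R⁻¹) (gs k)) w =
        conjHom (P * R⁻¹) (FreeGroup.lift gs w) :=
      DFunLike.congr_fun (FreeGroup.ext_hom
        (f := FreeGroup.lift (fun k => conjHom (P * R⁻¹) (gs k)))
        (g := (conjHom (P * R⁻¹)).comp (FreeGroup.lift gs)) (fun k => by simp)) w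
    rw [hlift]
    apply Subtype.ext
    change ((P * R⁻¹ : GL (Fin 2) K) : Matrix (Fin 2) (Fin 2) K) * _ *
      (((P * R⁻¹)⁻¹ : GL (Fin 2) K) : Matrix (Fin 2) (Fin 2) K) = _
    rw [_root_.mul_inv_rev, inv_inv, Units.val_mul, Units.val_mul, ← Matrix.mul_assoc,
      Matrix.mul_assoc _ _ (R : Matrix (Fin 2) (Fin 2) K), hR, hgD]
    simp only [Matrix.mul_assoc, Units.inv_mul_cancel_left]
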